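/- arXiv:2408.04101 — 2 statements merged into one kernel-verified Lean document; each statement's English description precedes it below -/
import Mathlib

section
/- Let μ_X, μ_Y ∈ ℝ, σ_X, σ_Y > 0, ρ ∈ (−1,1) and n ≥ 1 an integer. Then, for every integer k ≥ 1, E[S_n^k] = (s^k e^{−(λ₊+λ₋)/2}/Γ(n/2)²) Σ_{j=0}^k C(k,j) (1+ρ)^j (ρ−1)^{k−j} Γ(j + n/2) Γ(k − j + n/2) M(j + n/2, n/2, λ₊/2) M(k − j + n/2, n/2, λ₋/2), where C(k,j) is the binomial coefficient. -/
open MeasureTheory ProbabilityTheory Real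

noncomputable section

/-- Modified Bessel function of the first kind,
`I ν y = ∑_{k=0}^∞ (y/2)^{2k+ν} / (k! Γ(k+ν+1))`. -/
def besselI (ν y : ℝ) : ℝ :=
  ∑' k : ℕ, (y / 2) ^ (2 * (k : ℝ) + ν) / ((k.factorial : ℝ) * Real.Gamma ((k : ℝ) + ν + 1))

/-- The density of the noncentral chi-square distribution with `r` degrees of freedom and
noncentrality parameter `lam` (for `lam = 0`, the chi-square density). -/
def ncChiSqPdf (r lam x : ℝ) : ℝ :=
  if x ≤ 0 then 0
  else if lam = 0 then x ^ (r / 2 - 1) * Real.exp (-x / 2) / (2 ^ (r / 2) * Real.Gamma (r / 2))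
  else (1 / 2) * Real.exp (-(x + lam) / 2) * (x / lam) ^ (r / 4 - 1 / 2) *
    besselI (r / 2 - 1) (Real.sqrt (lam * x))

/-- The noncentral chi-square distribution `χ'²_r(lam)` as a measure on `ℝ`. -/
def ncChiSq (r lam : ℝ) : Measure ℝ :=
  volume.withDensity fun x => ENNReal.ofReal (ncChiSqPdf r lam x)

/-- The law of the difference `T = V₁ - V₂` of independent noncentral chi-square random
variables `V₁ ~ χ'²_r(λ₁)` and `V₂ ~ χ'²_r(λ₂)`. -/
def ncChiSqDiff (r lam1 lam2 : ℝ) : Measure ℝ :=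
  Measure.map (fun p : ℝ × ℝ => p.1 - p.2) ((ncChiSq r lam1).prod (ncChiSq r lam2))

/-- The bivariate normal distribution with mean vector `(μX, μY)`, variances `(σX², σY²)` and
correlation coefficient `ρ`, realised as the law of
`(μX + σX N₁, μY + σY (ρ N₁ + √(1-ρ²) N₂))` for independent standard normals `N₁, N₂`. -/
def binormal (μX μY σX σY ρ : ℝ) : Measure (ℝ × ℝ) :=
  Measure.map (fun p : ℝ × ℝ =>
      (μX + σX * p.1, μY + σY * (ρ * p.1 + Real.sqrt (1 - ρ ^ 2) * p.2)))
    ((gaussianReal 0 1).prod (gaussianReal 0 1))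

/-- The law of the product `Z = XY` of bivariate normal random variables. -/
def prodNormal (μX μY σX σY ρ : ℝ) : Measure ℝ :=
  Measure.map (fun p : ℝ × ℝ => p.1 * p.2) (binormal μX μY σX σY ρ)

/-- The law of the sum `Sₙ = Z₁ + ⋯ + Zₙ` of `n` independent copies of `Z = XY`. -/
def sumProdNormal (n : ℕ) (μX μY σX σY ρ : ℝ) : Measure ℝ :=
  Measure.map (fun x : Fin n → ℝ => ∑ i, x i)
    (Measure.pi fun _ : Fin n => prodNormal μX μY σX σY ρ)

/-- The confluent hypergeometric function of the first kind,
`M(a,b,x) = ∑_{k=0}^∞ ((a)_k/(b)_k) x^k/k!`, where `(a)_k` is the Pochhammer symbol. -/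
def hypM (a b x : ℝ) : ℝ :=
  ∑' k : ℕ, ((ascPochhammer ℝ k).eval a / (ascPochhammer ℝ k).eval b) * x ^ k /
    (k.factorial : ℝ)

/-- Chu–Vandermonde for rising factorials. -/
lemma ascPochhammer_eval_add (a b : ℝ) (k : ℕ) :
    (ascPochhammer ℝ k).eval (a + b) = ∑ ij ∈ Finset.HasAntidiagonal.antidiagonal k,
      (k.choose ij.1 : ℝ) *
        ((ascPochhammer ℝ ij.1).eval a * (ascPochhammer ℝ ij.2).eval b) := by
  have h := Ring.descPochhammer_smeval_add (r := -a) (s := -b) k (Commute.all _ _)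
  have key (r : ℝ) (n : ℕ) : (descPochhammer ℤ n).smeval (-r) =
      (-1) ^ n * (ascPochhammer ℝ n).eval r := by
    have := Polynomial.ascPochhammer_smeval_neg_eq_descPochhammer (-r) n
    rw [neg_neg, Polynomial.ascPochhammer_smeval_eq_eval] at this
    rw [this]
    rcases Nat.even_or_odd n with hn | hn
    · rw [Int.negOnePow_even _ (by exact_mod_cast hn), hn.neg_one_pow]; simp
    · rw [Int.negOnePow_odd _ (by exact_mod_cast hn), hn.neg_one_pow]; simp
  rw [show -a + -b = -(a + b) by ring] at h
  simp only [key] at h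
  have h2 : ((-1 : ℝ) ^ k) * (-1) ^ k = 1 := by rw [← mul_pow]; norm_num
  calc (ascPochhammer ℝ k).eval (a + b)
      = (-1) ^ k * ((-1) ^ k * (ascPochhammer ℝ k).eval (a + b)) := by
        rw [← mul_assoc, h2, one_mul]
    _ = _ := by
      rw [h, Finset.mul_sum]
      refine Finset.sum_congr rfl fun ij hij => ?_
      rw [Finset.HasAntidiagonal.mem_antidiagonal] at hij
      subst hij
      rw [pow_add] at h2 ⊢
      linear_combination ((ij.1 + ij.2).choose ij.1 : ℝ) *
        ((ascPochhammer ℝ ij.1).eval a * (ascPochhammer ℝ ij.2).eval b) * h2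

lemma ascPochhammer_eval_mul (a : ℝ) (n m : ℕ) :
    (ascPochhammer ℝ n).eval a * (ascPochhammer ℝ m).eval (a + n) =
      (ascPochhammer ℝ (n + m)).eval a := by
  rw [← ascPochhammer_mul]; simp

lemma ascPochhammer_eval_swap (a : ℝ) (n m : ℕ) :
    (ascPochhammer ℝ n).eval a * (ascPochhammer ℝ m).eval (a + n) =
      (ascPochhammer ℝ m).eval a * (ascPochhammer ℝ n).eval (a + m) := by
  rw [ascPochhammer_eval_mul, ascPochhammer_eval_mul, add_comm]

lemma Gamma_add_natCast {a : ℝ} (ha : 0 < a) (n : ℕ) :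
    Real.Gamma (a + n) = (ascPochhammer ℝ n).eval a * Real.Gamma a := by
  induction n with
  | zero => simp
  | succ n ih =>
    rw [Nat.cast_succ, ← add_assoc, Real.Gamma_add_one (by positivity), ih,
      ascPochhammer_succ_eval]
    ring

/-- The normalised rising factorial `(a)_j / j!`, the coefficient of `t ^ j` in `(1 - t) ^ (-a)`. -/
def risingCoeff (j : ℕ) (a : ℝ) : ℝ := (ascPochhammer ℝ j).eval a / (j.factorial : ℝ)

lemma risingCoeff_add (a b : ℝ) (k : ℕ) :
    risingCoeff k (a + b) =
      ∑ ij ∈ Finset.HasAntidiagonal.antidiagonal k, risingCoeff ij.1 a * risingCoeff ij.2 b := by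
  rw [risingCoeff, ascPochhammer_eval_add, Finset.sum_div]
  refine Finset.sum_congr rfl fun ij hij => ?_
  rw [Finset.HasAntidiagonal.mem_antidiagonal] at hij
  subst hij
  rw [risingCoeff, risingCoeff, Nat.cast_add_choose]
  have h1 : ((ij.1).factorial : ℝ) ≠ 0 := by positivity
  have h2 : ((ij.2).factorial : ℝ) ≠ 0 := by positivity
  have h3 : ((ij.1 + ij.2).factorial : ℝ) ≠ 0 := by positivity
  field_simp

lemma ascPochhammer_eval_nonneg_le {y : ℝ} (hy : 0 ≤ y) (j : ℕ) :
    0 ≤ (ascPochhammer ℝ j).eval y ∧ (ascPochhammer ℝ j).eval y ≤ (y + j) ^ j := by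
  induction j with
  | zero => simp
  | succ j ih =>
    rw [ascPochhammer_succ_eval, pow_succ]
    push_cast
    refine ⟨mul_nonneg ih.1 (by positivity), ?_⟩
    gcongr
    · exact ih.2.trans (by gcongr; linarith)
    · linarith

/-- The Poisson mixture coefficient series converges. -/
lemma summable_risingCoeff {r x : ℝ} (hr : 0 ≤ r) (hx : 0 ≤ x) (j : ℕ) :
    Summable fun k : ℕ => x ^ k / (k.factorial : ℝ) * risingCoeff j (r + k) := by
  have hs := (Real.summable_pow_div_factorial (x * rexp 1)).mul_left (rexp (r + j))
  refine Summable.of_nonneg_of_le (fun k => ?_) (fun k => ?_) hs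
  · have := (ascPochhammer_eval_nonneg_le (y := r + k) (by positivity) j).1
    rw [risingCoeff]; positivity
  · have h := (ascPochhammer_eval_nonneg_le (y := r + k) (by positivity) j).2
    have h2 := Real.pow_div_factorial_le_exp (x := r + k + j) (by positivity) j
    have h3 : risingCoeff j (r + k) ≤ rexp (r + k + j) :=
      (div_le_div_of_nonneg_right h (by positivity)).trans h2
    calc x ^ k / (k.factorial : ℝ) * risingCoeff j (r + k)
        ≤ x ^ k / (k.factorial : ℝ) * rexp (r + k + j) := by gcongr
      _ = rexp (r + j) * ((x * rexp 1) ^ k / (k.factorial : ℝ)) := by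
        rw [mul_pow, ← Real.exp_nat_mul, mul_one, show r + k + j = (r + j) + k by ring,
          Real.exp_add]
        ring

/-- With `r` half the degrees of freedom and `x` half the noncentrality parameter, the exponential
moment generating series of half a noncentral chi-square random variable. -/
def ncChiSqSeries (r x : ℝ) : PowerSeries ℝ :=
  PowerSeries.mk fun j =>
    rexp (-x) * ∑' k : ℕ, x ^ k / (k.factorial : ℝ) * risingCoeff j (r + k)

lemma ncChiSqSeries_add {r₁ r₂ x₁ x₂ : ℝ} (hr₁ : 0 ≤ r₁) (hr₂ : 0 ≤ r₂) (hx₁ : 0 ≤ x₁)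
    (hx₂ : 0 ≤ x₂) :
    ncChiSqSeries (r₁ + r₂) (x₁ + x₂) = ncChiSqSeries r₁ x₁ * ncChiSqSeries r₂ x₂ := by
  ext j
  rw [PowerSeries.coeff_mul]
  simp only [ncChiSqSeries, PowerSeries.coeff_mk]
  have hprod (p : ℕ × ℕ) := (summable_risingCoeff hr₁ hx₁ p.1).tsum_mul_tsum_eq_tsum_sum_antidiagonal
      (summable_risingCoeff hr₂ hx₂ p.2)
      (summable_mul_of_summable_norm (summable_risingCoeff hr₁ hx₁ p.1).norm
        (summable_risingCoeff hr₂ hx₂ p.2).norm)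
  have hsum (p : ℕ × ℕ) := (summable_norm_sum_mul_antidiagonal_of_summable_norm
    (summable_risingCoeff hr₁ hx₁ p.1).norm (summable_risingCoeff hr₂ hx₂ p.2).norm).of_norm
  simp_rw [mul_mul_mul_comm (rexp (-x₁)), hprod, ← Finset.mul_sum, ← Real.exp_add]
  rw [← Summable.tsum_finsetSum fun p _ => hsum p]
  congr 1
  · congr 1; ring
  refine tsum_congr fun K => ?_
  rw [Finset.sum_comm, add_pow, ← Finset.Nat.sum_antidiagonal_eq_sum_range_succ_mk
    (f := fun m : ℕ × ℕ => x₁ ^ m.1 * x₂ ^ m.2 * (K.choose m.1 : ℝ)),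
    Finset.sum_div, Finset.sum_mul]
  refine Finset.sum_congr rfl fun m hm => ?_
  rw [Finset.HasAntidiagonal.mem_antidiagonal] at hm
  subst hm
  rw [show r₁ + r₂ + ((m.1 + m.2 : ℕ) : ℝ) = (r₁ + m.1) + (r₂ + m.2) by push_cast; ring,
    risingCoeff_add, Finset.mul_sum]
  refine Finset.sum_congr rfl fun p _ => ?_
  rw [Nat.cast_add_choose]
  have h1 : ((m.1).factorial : ℝ) ≠ 0 := by positivity
  have h2 : ((m.2).factorial : ℝ) ≠ 0 := by positivity
  have h3 : ((m.1 + m.2).factorial : ℝ) ≠ 0 := by positivity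
  field_simp

lemma ncChiSqSeries_zero : ncChiSqSeries 0 0 = 1 := by
  ext j
  simp only [ncChiSqSeries, PowerSeries.coeff_mk]
  rw [tsum_eq_single 0 (fun k hk => by simp [hk])]
  rcases eq_or_ne j 0 with rfl | hj
  · simp [risingCoeff]
  · simp [risingCoeff, hj, PowerSeries.coeff_one]

lemma ncChiSqSeries_pow {r x : ℝ} (hr : 0 ≤ r) (hx : 0 ≤ x) (n : ℕ) :
    ncChiSqSeries r x ^ n = ncChiSqSeries (n * r) (n * x) := by
  induction n with
  | zero => simp [ncChiSqSeries_zero]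
  | succ n ih =>
    rw [pow_succ, ih, ← ncChiSqSeries_add (by positivity) hr (by positivity) hx]
    push_cast
    ring_nf

lemma Gamma_mul_hypM {r : ℝ} (hr : 0 < r) (x : ℝ) (j : ℕ) :
    Real.Gamma (j + r) * hypM (j + r) r x =
      Real.Gamma r * rexp x * (j.factorial : ℝ) * PowerSeries.coeff j (ncChiSqSeries r x) := by
  simp only [ncChiSqSeries, PowerSeries.coeff_mk, hypM]
  have he : Real.Gamma r * rexp x * (j.factorial : ℝ) * (rexp (-x) *
      ∑' k : ℕ, x ^ k / (k.factorial : ℝ) * risingCoeff j (r + k)) =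
      (Real.Gamma r * (j.factorial : ℝ)) *
      ∑' k : ℕ, x ^ k / (k.factorial : ℝ) * risingCoeff j (r + k) := by
    rw [Real.exp_neg]
    field_simp
  rw [he, ← tsum_mul_left, ← tsum_mul_left]
  refine tsum_congr fun k => ?_
  have hp := ascPochhammer_pos k r hr
  have h := ascPochhammer_eval_swap r j k
  rw [add_comm (j : ℝ) r, Gamma_add_natCast hr, risingCoeff]
  field_simp
  linear_combination x ^ k * h

/-- The exponential generating series of the moments of `X` under `μ`. -/
def momentSeries {Ω : Type*} [MeasurableSpace Ω] (X : Ω → ℝ) (μ : Measure Ω) : PowerSeries ℝ :=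
  PowerSeries.mk fun j => (∫ ω, X ω ^ j ∂μ) / (j.factorial : ℝ)

section
variable {Ω Ω' : Type*} [MeasurableSpace Ω] [MeasurableSpace Ω'] {μ : Measure Ω} {ν : Measure Ω'}

lemma momentSeries_const_mul (X : Ω → ℝ) (c : ℝ) :
    momentSeries (fun ω => c * X ω) μ = PowerSeries.rescale c (momentSeries X μ) := by
  ext j
  simp only [momentSeries, PowerSeries.coeff_mk, PowerSeries.coeff_rescale, mul_pow,
    integral_const_mul, mul_div_assoc]

lemma momentSeries_map {X : Ω' → ℝ} {f : Ω → Ω'} (hX : Measurable X) (hf : Measurable f) :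
    momentSeries X (μ.map f) = momentSeries (fun ω => X (f ω)) μ := by
  ext j
  simp only [momentSeries, PowerSeries.coeff_mk]
  rw [integral_map hf.aemeasurable (hX.pow_const j).aestronglyMeasurable]

lemma integrable_add_pow_prod [SFinite μ] [SFinite ν] {X : Ω → ℝ} {Y : Ω' → ℝ}
    (hX : ∀ j : ℕ, Integrable (fun ω => X ω ^ j) μ) (hY : ∀ j : ℕ, Integrable (fun ω => Y ω ^ j) ν)
    (j : ℕ) : Integrable (fun p : Ω × Ω' => (X p.1 + Y p.2) ^ j) (μ.prod ν) := by
  simp_rw [add_pow]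
  exact integrable_finsetSum _ fun i _ => ((hX i).mul_prod (hY (j - i))).mul_const _

lemma momentSeries_add_prod [SFinite μ] [SFinite ν] {X : Ω → ℝ} {Y : Ω' → ℝ}
    (hX : ∀ j : ℕ, Integrable (fun ω => X ω ^ j) μ)
    (hY : ∀ j : ℕ, Integrable (fun ω => Y ω ^ j) ν) :
    momentSeries (fun p : Ω × Ω' => X p.1 + Y p.2) (μ.prod ν) =
      momentSeries X μ * momentSeries Y ν := by
  ext j
  rw [PowerSeries.coeff_mul]
  simp only [momentSeries, PowerSeries.coeff_mk, add_pow]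
  rw [integral_finsetSum _ fun i _ => ((hX i).mul_prod (hY (j - i))).mul_const _,
    Finset.Nat.sum_antidiagonal_eq_sum_range_succ (f := fun i l =>
      (∫ ω, X ω ^ i ∂μ) / (i.factorial : ℝ) * ((∫ ω, Y ω ^ l ∂ν) / (l.factorial : ℝ))),
    Finset.sum_div]
  refine Finset.sum_congr rfl fun i hi => ?_
  rw [integral_mul_const, integral_prod_mul (fun ω => X ω ^ i) (fun ω => Y ω ^ (j - i)),
    Nat.cast_choose ℝ (Finset.mem_range_succ_iff.1 hi)]
  have h1 : (i.factorial : ℝ) ≠ 0 := by positivity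
  have h2 : ((j - i).factorial : ℝ) ≠ 0 := by positivity
  have h3 : (j.factorial : ℝ) ≠ 0 := by positivity
  field_simp

lemma momentSeries_sum_pi [IsProbabilityMeasure μ] {X : Ω → ℝ} (hXm : Measurable X)
    (hX : ∀ j : ℕ, Integrable (fun ω => X ω ^ j) μ) (n : ℕ) :
    momentSeries (fun x : Fin n → Ω => ∑ i, X (x i)) (Measure.pi fun _ => μ) =
        momentSeries X μ ^ n ∧
      ∀ j : ℕ, Integrable (fun x : Fin n → Ω => (∑ i, X (x i)) ^ j) (Measure.pi fun _ => μ) := by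
  induction n with
  | zero =>
    refine ⟨?_, fun j => by simp⟩
    ext j
    simp only [momentSeries, PowerSeries.coeff_mk]
    rcases eq_or_ne j 0 with rfl | hj
    · simp
    · simp [hj, PowerSeries.coeff_one]
  | succ n ih =>
    have hmp := measurePreserving_piFinSuccAbove (fun _ : Fin (n + 1) => μ) 0
    have he : (fun x : Fin (n + 1) → Ω => ∑ i, X (x i)) = fun x =>
        (fun p : Ω × (Fin n → Ω) => X p.1 + ∑ i, X (p.2 i))
          (MeasurableEquiv.piFinSuccAbove (fun _ : Fin (n + 1) => Ω) 0 x) := by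
      funext x
      simp [Fin.sum_univ_succ, MeasurableEquiv.piFinSuccAbove, Fin.tail]
    have hm : Measurable fun p : Ω × (Fin n → Ω) => X p.1 + ∑ i, X (p.2 i) := by fun_prop
    constructor
    · rw [he, ← momentSeries_map hm hmp.measurable, hmp.map_eq, pow_succ', ← ih.1]
      exact momentSeries_add_prod hX ih.2
    · intro j
      have := hmp.integrable_comp_of_integrable (integrable_add_pow_prod hX ih.2 j)
      refine this.congr (Filter.Eventually.of_forall fun x => ?_)
      exact congrArg (· ^ j) (congrFun he x).symm

end

lemma integrable_pow_mul_exp_gaussianReal (v : ℝ) (j : ℕ) :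
    Integrable (fun x => x ^ j * rexp (v * x)) (gaussianReal 0 1) :=
  integrable_pow_mul_exp_of_mem_interior_integrableExpSet (X := fun x : ℝ => x)
    (by simp [integrableExpSet_fun_id_gaussianReal]) j

lemma integrable_pow_gaussianReal (a : ℝ) (j : ℕ) :
    Integrable (fun x => x ^ j) (gaussianReal a 1) :=
  integrable_pow_of_mem_interior_integrableExpSet (X := fun x : ℝ => x)
    (by simp [integrableExpSet_fun_id_gaussianReal]) j

lemma integrable_shifted_sq_pow_gaussianReal (a : ℝ) (j : ℕ) :
    Integrable (fun x => ((a + x) ^ 2) ^ j) (gaussianReal 0 1) := by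
  have h := integrable_pow_gaussianReal a (2 * j)
  rw [← add_zero a, add_comm, ← gaussianReal_map_const_add,
    integrable_map_measure (by fun_prop) (by fun_prop)] at h
  refine h.congr (Filter.Eventually.of_forall fun x => ?_)
  simp [pow_mul]

lemma integral_even_pow_gaussianReal (m : ℕ) :
    ∫ x, x ^ (2 * m) ∂(gaussianReal 0 1) = 2 ^ m * (ascPochhammer ℝ m).eval (1 / 2) := by
  have h := integral_rpow_mul_exp_neg_mul_rpow (p := 2) (q := 2 * (m : ℝ)) (b := 1 / 2)
    (by norm_num) (by linarith [(Nat.cast_nonneg m : (0 : ℝ) ≤ m)]) (by norm_num)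
  have habs := integral_comp_abs (f := fun x : ℝ => x ^ (2 * (m : ℝ)) * rexp (-(1 / 2) * x ^ (2 : ℝ)))
  rw [integral_gaussianReal_eq_integral_smul one_ne_zero]
  have he : (fun x : ℝ => gaussianPDFReal 0 1 x • x ^ (2 * m)) = fun x =>
      (√(2 * π))⁻¹ * (|x| ^ (2 * (m : ℝ)) * rexp (-(1 / 2) * |x| ^ (2 : ℝ))) := by
    funext x
    have h1 : |x| ^ (2 * (m : ℝ)) = x ^ (2 * m) := by
      rw [show (2 * (m : ℝ)) = ((2 * m : ℕ) : ℝ) by push_cast; ring, Real.rpow_natCast, pow_mul,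
        sq_abs, pow_mul]
    rw [h1, Real.rpow_two, sq_abs, gaussianPDFReal_def]
    simp only [NNReal.coe_one, mul_one, sub_zero, smul_eq_mul]
    rw [show -x ^ 2 / 2 = -(1 / 2) * x ^ 2 by ring]
    ring
  have hb : (1 / 2 : ℝ) ^ (-(2 * (m : ℝ) + 1) / 2) = √2 * 2 ^ m := by
    rw [show -(2 * (m : ℝ) + 1) / 2 = -(1 / 2 + m) by ring, one_div (2 : ℝ),
      Real.inv_rpow (by norm_num), Real.rpow_neg (by norm_num), inv_inv, ← one_div,
      Real.rpow_add (by norm_num), Real.rpow_natCast, ← Real.sqrt_eq_rpow]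
  rw [he, integral_const_mul, habs, h, hb, show (2 * (m : ℝ) + 1) / 2 = 1 / 2 + m by ring,
    Gamma_add_natCast (by norm_num), Real.Gamma_one_half_eq, Real.sqrt_mul (by norm_num)]
  have h2 : √(2 : ℝ) ≠ 0 := by positivity
  have h3 : √π ≠ 0 := by positivity
  field_simp

lemma factorial_two_mul_eq (k : ℕ) :
    ((2 * k).factorial : ℝ) = 4 ^ k * (k.factorial : ℝ) * (ascPochhammer ℝ k).eval (1 / 2) := by
  induction k with
  | zero => simp
  | succ k ih =>
    rw [show 2 * (k + 1) = 2 * k + 1 + 1 by ring, Nat.factorial_succ, Nat.factorial_succ,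
      Nat.factorial_succ, ascPochhammer_succ_eval]
    push_cast
    rw [ih]
    ring

lemma integral_pow_mul_exp_gaussianReal (a : ℝ) (j : ℕ) :
    ∫ x, x ^ (2 * j) * rexp (a * x) ∂(gaussianReal 0 1) =
      ∫ x, x ^ (2 * j) * Real.cosh (a * x) ∂(gaussianReal 0 1) := by
  have hneg : ∫ x, x ^ (2 * j) * rexp (-a * x) ∂(gaussianReal 0 1) =
      ∫ x, x ^ (2 * j) * rexp (a * x) ∂(gaussianReal 0 1) := by
    conv_rhs => rw [← neg_zero, ← gaussianReal_map_neg, integral_map (by fun_prop) (by fun_prop)]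
    refine integral_congr_ae (Filter.Eventually.of_forall fun x => ?_)
    simp [pow_mul]
  have hc : (fun x : ℝ => x ^ (2 * j) * Real.cosh (a * x)) = fun x =>
      (x ^ (2 * j) * rexp (a * x) + x ^ (2 * j) * rexp (-a * x)) / 2 := by
    funext x
    rw [Real.cosh_eq, neg_mul]
    ring
  rw [hc, integral_div, integral_add (integrable_pow_mul_exp_gaussianReal a _)
    (integrable_pow_mul_exp_gaussianReal (-a) _), hneg]
  ring

lemma integral_pow_mul_cosh_gaussianReal (a : ℝ) (j : ℕ) :
    ∫ x, x ^ (2 * j) * Real.cosh (a * x) ∂(gaussianReal 0 1) =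
      2 ^ j * (j.factorial : ℝ) *
        ∑' k : ℕ, (a ^ 2 / 2) ^ k / (k.factorial : ℝ) * risingCoeff j (1 / 2 + k) := by
  set F : ℕ → ℝ → ℝ := fun k x => x ^ (2 * j) * ((a * x) ^ (2 * k) / ((2 * k).factorial : ℝ))
    with hF
  have hFeq (k : ℕ) : F k = fun x => a ^ (2 * k) / ((2 * k).factorial : ℝ) * x ^ (2 * (k + j)) := by
    funext x
    simp only [hF]
    ring
  have hFint (k : ℕ) : Integrable (F k) (gaussianReal 0 1) := by
    rw [hFeq]
    exact (integrable_pow_gaussianReal 0 _).const_mul _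
  have hFnonneg (k : ℕ) (x : ℝ) : 0 ≤ F k x := by
    simp only [hF, pow_mul]
    positivity
  have hFval (k : ℕ) : ∫ x, F k x ∂(gaussianReal 0 1) = 2 ^ j * (j.factorial : ℝ) *
      ((a ^ 2 / 2) ^ k / (k.factorial : ℝ) * risingCoeff j (1 / 2 + k)) := by
    rw [hFeq, integral_const_mul, integral_even_pow_gaussianReal, ← ascPochhammer_eval_mul,
      factorial_two_mul_eq, risingCoeff]
    have hp := ascPochhammer_pos k (1 / 2 : ℝ) (by norm_num)
    have h1 : (j.factorial : ℝ) ≠ 0 := by positivity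
    have h4 : (4 : ℝ) ^ k = 2 ^ k * 2 ^ k := by rw [← mul_pow]; norm_num
    rw [h4, pow_mul, div_pow, pow_add]
    field_simp
  have hs := hasSum_integral_of_summable_integral_norm hFint (by
    simp only [Real.norm_of_nonneg (hFnonneg _ _), hFval]
    exact (summable_risingCoeff (by norm_num) (by positivity) j).mul_left _)
  have hcosh : (fun x : ℝ => x ^ (2 * j) * Real.cosh (a * x)) = fun x => ∑' k, F k x := by
    funext x
    exact ((Real.hasSum_cosh (a * x)).mul_left (x ^ (2 * j))).tsum_eq.symm
  rw [hcosh, ← hs.tsum_eq, ← tsum_mul_left]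
  exact tsum_congr hFval

lemma integral_shifted_sq_pow_gaussianReal (a : ℝ) (j : ℕ) :
    ∫ x, ((a + x) ^ 2) ^ j ∂(gaussianReal 0 1) =
      rexp (-(a ^ 2 / 2)) * ∫ x, x ^ (2 * j) * rexp (a * x) ∂(gaussianReal 0 1) := by
  have h : ∫ x, ((a + x) ^ 2) ^ j ∂(gaussianReal 0 1) = ∫ x, x ^ (2 * j) ∂(gaussianReal a 1) := by
    conv_rhs => rw [← zero_add a, ← gaussianReal_map_const_add,
      integral_map (by fun_prop) (by fun_prop)]
    simp only [pow_mul]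
  rw [h, integral_gaussianReal_eq_integral_smul one_ne_zero,
    integral_gaussianReal_eq_integral_smul one_ne_zero, ← integral_const_mul]
  refine integral_congr_ae (Filter.Eventually.of_forall fun x => ?_)
  simp only [gaussianPDFReal_def, NNReal.coe_one, mul_one, sub_zero, smul_eq_mul]
  rw [show -(x - a) ^ 2 / 2 = -(a ^ 2 / 2) + (-x ^ 2 / 2 + a * x) by ring, Real.exp_add,
    Real.exp_add]
  ring

lemma momentSeries_shifted_sq_gaussianReal (a : ℝ) :
    momentSeries (fun x => (a + x) ^ 2) (gaussianReal 0 1) =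
      PowerSeries.rescale 2 (ncChiSqSeries (1 / 2) (a ^ 2 / 2)) := by
  ext j
  rw [PowerSeries.coeff_rescale]
  simp only [momentSeries, ncChiSqSeries, PowerSeries.coeff_mk]
  rw [integral_shifted_sq_pow_gaussianReal, integral_pow_mul_exp_gaussianReal,
    integral_pow_mul_cosh_gaussianReal]
  have h1 : (j.factorial : ℝ) ≠ 0 := by positivity
  field_simp

/-- The law of the product of correlated normals as that of a weighted difference of independent
squares of shifted normals. -/
lemma prodNormal_eq_map (μX μY σX σY ρ : ℝ) (hσX : 0 < σX) (hσY : 0 < σY)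
    (hρ : ρ ∈ Set.Ioo (-1 : ℝ) 1) :
    prodNormal μX μY σX σY ρ =
      ((gaussianReal 0 1).prod (gaussianReal 0 1)).map (fun q : ℝ × ℝ =>
        σX * σY * ((1 + ρ) / 2) * ((μX / σX + μY / σY) / √(2 * (1 + ρ)) + q.1) ^ 2 +
          σX * σY * ((ρ - 1) / 2) * ((μY / σY - μX / σX) / √(2 * (1 - ρ)) + q.2) ^ 2) := by
  obtain ⟨h1, h2⟩ := hρ
  have hp : 0 < 1 + ρ := by linarith
  have hm : 0 < 1 - ρ := by linarith
  set c := √((1 + ρ) / 2) with hc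
  set s := √((1 - ρ) / 2) with hs
  have hc0 : 0 < c := by positivity
  have hs0 : 0 < s := by positivity
  have hc2 : c ^ 2 = (1 + ρ) / 2 := Real.sq_sqrt (by positivity)
  have hs2 : s ^ 2 = (1 - ρ) / 2 := Real.sq_sqrt (by positivity)
  have hcos : Real.cos (Real.arccos c) = c := Real.cos_arccos (by linarith) (by nlinarith)
  have hsin : Real.sin (Real.arccos c) = s := by
    rw [Real.sin_arccos, hc2, hs]
    congr 1
    ring
  have hA : √(2 * (1 + ρ)) = 2 * c := by
    rw [show 2 * (1 + ρ) = (2 * c) ^ 2 by rw [mul_pow, hc2]; ring, Real.sqrt_sq (by positivity)]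
  have hB : √(2 * (1 - ρ)) = 2 * s := by
    rw [show 2 * (1 - ρ) = (2 * s) ^ 2 by rw [mul_pow, hs2]; ring, Real.sqrt_sq (by positivity)]
  have hC : √(1 - ρ ^ 2) = 2 * c * s := by
    rw [show 1 - ρ ^ 2 = (2 * c * s) ^ 2 by rw [mul_pow, mul_pow, hc2, hs2]; ring,
      Real.sqrt_sq (by positivity)]
  have hρc : ρ = c ^ 2 - s ^ 2 := by rw [hc2, hs2]; ring
  have hcs : c ^ 2 + s ^ 2 = 1 := by rw [hc2, hs2]; ring
  have hrot := IsGaussian.map_rotation_eq_self (μ := gaussianReal 0 1) (by simp) (Real.arccos c)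
  rw [prodNormal, binormal, Measure.map_map (by fun_prop) (by fun_prop)]
  conv_rhs => rw [← hrot, Measure.map_map (by fun_prop) (by fun_prop)]
  congr 1
  funext p
  simp only [Function.comp, ContinuousLinearMap.rotation_apply, hcos, hsin, hA, hB, hC,
    smul_eq_mul]
  rw [← hc2, show (ρ - 1) / 2 = -s ^ 2 by rw [hs2]; ring]
  have e1 : c ^ 2 * ((μX / σX + μY / σY) / (2 * c) + (c * p.1 + s * p.2)) ^ 2 =
      ((μX / σX + μY / σY) / 2 + c * (c * p.1 + s * p.2)) ^ 2 := by
    field_simp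
  have e2 : s ^ 2 * ((μY / σY - μX / σX) / (2 * s) + (-s * p.1 + c * p.2)) ^ 2 =
      ((μY / σY - μX / σX) / 2 + s * (-s * p.1 + c * p.2)) ^ 2 := by
    field_simp
  rw [mul_assoc (σX * σY) (c ^ 2), e1, mul_assoc (σX * σY) (-s ^ 2), neg_mul, e2,
    ← mul_add, ← sub_eq_add_neg, sq_sub_sq]
  have f1 : μX + σX * p.1 = σX * (μX / σX + p.1) := by field_simp
  have f2 : μY + σY * (ρ * p.1 + 2 * c * s * p.2) =
      σY * (μY / σY + (ρ * p.1 + 2 * c * s * p.2)) := by field_simp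
  rw [f1, f2, hρc, mul_mul_mul_comm]
  congr 1
  have g : (μX / σX + μY / σY) / 2 + c * (c * p.1 + s * p.2) -
      ((μY / σY - μX / σX) / 2 + s * (-s * p.1 + c * p.2)) = μX / σX + p.1 := by
    linear_combination p.1 * hcs
  rw [g]
  ring

lemma momentSeries_prodNormal (μX μY σX σY ρ : ℝ) (hσX : 0 < σX) (hσY : 0 < σY)
    (hρ : ρ ∈ Set.Ioo (-1 : ℝ) 1) :
    momentSeries (fun x => x) (prodNormal μX μY σX σY ρ) =
        PowerSeries.rescale (σX * σY * (1 + ρ))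
          (ncChiSqSeries (1 / 2) ((μX / σX + μY / σY) ^ 2 / (2 * (1 + ρ)) / 2)) *
        PowerSeries.rescale (σX * σY * (ρ - 1))
          (ncChiSqSeries (1 / 2) ((μX / σX - μY / σY) ^ 2 / (2 * (1 - ρ)) / 2)) ∧
      ∀ j : ℕ, Integrable (fun x => x ^ j) (prodNormal μX μY σX σY ρ) := by
  have h_integrable (c a : ℝ) (j : ℕ) :
      Integrable (fun x => (c * (a + x) ^ 2) ^ j) (gaussianReal 0 1) := by
    simp_rw [mul_pow c]
    exact (integrable_shifted_sq_pow_gaussianReal a j).const_mul _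
  rw [prodNormal_eq_map μX μY σX σY ρ hσX hσY hρ]
  constructor
  · rw [momentSeries_map measurable_id' (by fun_prop),
      momentSeries_add_prod (h_integrable _ _) (h_integrable _ _),
      momentSeries_const_mul, momentSeries_const_mul, momentSeries_shifted_sq_gaussianReal,
      momentSeries_shifted_sq_gaussianReal, PowerSeries.rescale_rescale,
      PowerSeries.rescale_rescale, div_pow, div_pow, Real.sq_sqrt (by linarith [hρ.1]),
      Real.sq_sqrt (by linarith [hρ.2]), sub_sq_comm (μY / σY)]
    congr 3 <;> ring
  · intro j
    rw [integrable_map_measure (by fun_prop) (by fun_prop)]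
    exact integrable_add_pow_prod (h_integrable _ _) (h_integrable _ _) j

instance isProbabilityMeasure_prodNormal (μX μY σX σY ρ : ℝ) :
    IsProbabilityMeasure (prodNormal μX μY σX σY ρ) := by
  have h : IsProbabilityMeasure (binormal μX μY σX σY ρ) :=
    Measure.isProbabilityMeasure_map (by fun_prop)
  exact Measure.isProbabilityMeasure_map (by fun_prop)

lemma momentSeries_sumProdNormal (μX μY σX σY ρ : ℝ) (hσX : 0 < σX) (hσY : 0 < σY)
    (hρ : ρ ∈ Set.Ioo (-1 : ℝ) 1) (n : ℕ) :
    momentSeries (fun x => x) (sumProdNormal n μX μY σX σY ρ) =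
      PowerSeries.rescale (σX * σY * (1 + ρ))
        (ncChiSqSeries (n / 2) (n / (2 * (1 + ρ)) * (μX / σX + μY / σY) ^ 2 / 2)) *
      PowerSeries.rescale (σX * σY * (ρ - 1))
        (ncChiSqSeries (n / 2) (n / (2 * (1 - ρ)) * (μX / σX - μY / σY) ^ 2 / 2)) := by
  have hp : 0 < 1 + ρ := by linarith [hρ.1]
  have hm : 0 < 1 - ρ := by linarith [hρ.2]
  obtain ⟨h1, h2⟩ := momentSeries_prodNormal μX μY σX σY ρ hσX hσY hρ
  rw [sumProdNormal, momentSeries_map measurable_id' (by fun_prop),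
    (momentSeries_sum_pi measurable_id' h2 n).1, h1, mul_pow, ← map_pow, ← map_pow,
    ncChiSqSeries_pow (by norm_num) (by positivity),
    ncChiSqSeries_pow (by norm_num) (by positivity)]
  congr 3 <;> ring

/-- Let `μX, μY ∈ ℝ`, `σX, σY > 0`, `ρ ∈ (-1,1)` and `n ≥ 1`. Then, for
every integer `k ≥ 1`, with `s = σX σY`, `λ₊ = (n/(2(1+ρ)))(μX/σX + μY/σY)²` and
`λ₋ = (n/(2(1-ρ)))(μX/σX - μY/σY)²`,
`E[Sₙ^k] = (s^k e^{-(λ₊+λ₋)/2}/Γ(n/2)²) ∑_{j=0}^k C(k,j) (1+ρ)^j (ρ-1)^{k-j} Γ(j + n/2)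
Γ(k - j + n/2) M(j + n/2, n/2, λ₊/2) M(k - j + n/2, n/2, λ₋/2)`. -/
theorem sumProdNormal_moments (μX μY σX σY ρ : ℝ) (hσX : 0 < σX) (hσY : 0 < σY)
    (hρ : ρ ∈ Set.Ioo (-1 : ℝ) 1) (n : ℕ) (hn : 1 ≤ n) (k : ℕ) (hk : 1 ≤ k) :
    ∫ x, x ^ k ∂(sumProdNormal n μX μY σX σY ρ) =
      (σX * σY) ^ k *
        Real.exp (-(((n : ℝ) / (2 * (1 + ρ)) * (μX / σX + μY / σY) ^ 2) +
            ((n : ℝ) / (2 * (1 - ρ)) * (μX / σX - μY / σY) ^ 2)) / 2) /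
          Real.Gamma ((n : ℝ) / 2) ^ 2 *
        ∑ j ∈ Finset.range (k + 1),
          (k.choose j : ℝ) * (1 + ρ) ^ j * (ρ - 1) ^ (k - j) *
            Real.Gamma ((j : ℝ) + (n : ℝ) / 2) *
            Real.Gamma ((k : ℝ) - (j : ℝ) + (n : ℝ) / 2) *
            hypM ((j : ℝ) + (n : ℝ) / 2) ((n : ℝ) / 2)
              (((n : ℝ) / (2 * (1 + ρ)) * (μX / σX + μY / σY) ^ 2) / 2) *
            hypM ((k : ℝ) - (j : ℝ) + (n : ℝ) / 2) ((n : ℝ) / 2)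
              (((n : ℝ) / (2 * (1 - ρ)) * (μX / σX - μY / σY) ^ 2) / 2) := by
  have hn0 : (0 : ℝ) < (n : ℝ) / 2 := by
    have : (0 : ℝ) < n := by exact_mod_cast hn
    positivity
  have hcoeff := congrArg (PowerSeries.coeff k)
    (momentSeries_sumProdNormal μX μY σX σY ρ hσX hσY hρ n)
  set x := (n : ℝ) / (2 * (1 + ρ)) * (μX / σX + μY / σY) ^ 2 with hx
  set y := (n : ℝ) / (2 * (1 - ρ)) * (μX / σX - μY / σY) ^ 2 with hy
  rw [PowerSeries.coeff_mul, Finset.Nat.sum_antidiagonal_eq_sum_range_succ (f := fun i l =>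
    PowerSeries.coeff i (PowerSeries.rescale (σX * σY * (1 + ρ)) (ncChiSqSeries (n / 2) (x / 2))) *
    PowerSeries.coeff l (PowerSeries.rescale (σX * σY * (ρ - 1)) (ncChiSqSeries (n / 2) (y / 2))))]
    at hcoeff
  simp only [momentSeries, PowerSeries.coeff_mk, PowerSeries.coeff_rescale] at hcoeff
  have hk0 : (k.factorial : ℝ) ≠ 0 := by positivity
  rw [div_eq_iff hk0] at hcoeff
  rw [hcoeff, Finset.sum_mul, Finset.mul_sum]
  refine Finset.sum_congr rfl fun j hj => ?_
  have hjk := Finset.mem_range_succ_iff.1 hj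
  have hG : Real.Gamma ((n : ℝ) / 2) ≠ 0 := (Real.Gamma_pos_of_pos hn0).ne'
  have e1 := Gamma_mul_hypM hn0 (x / 2) j
  have e2 := Gamma_mul_hypM hn0 (y / 2) (k - j)
  rw [Nat.cast_sub hjk] at e2
  have hexp : rexp (-(x + y) / 2) * (rexp (x / 2) * rexp (y / 2)) = 1 := by
    rw [← Real.exp_add, ← Real.exp_add, Real.exp_eq_one_iff]
    ring
  have hpow : (σX * σY) ^ k = (σX * σY) ^ j * (σX * σY) ^ (k - j) := by
    rw [← pow_add, Nat.add_sub_cancel' hjk]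
  have hfac : (k.choose j : ℝ) * (j.factorial : ℝ) * ((k - j).factorial : ℝ) = k.factorial := by
    exact_mod_cast Nat.choose_mul_factorial_mul_factorial hjk
  generalize PowerSeries.coeff j (ncChiSqSeries ((n : ℝ) / 2) (x / 2)) = P at *
  generalize PowerSeries.coeff (k - j) (ncChiSqSeries ((n : ℝ) / 2) (y / 2)) = Q at *
  calc _ = (σX * σY) ^ k * (rexp (-(x + y) / 2) * (rexp (x / 2) * rexp (y / 2))) *
        (1 + ρ) ^ j * (ρ - 1) ^ (k - j) * P * Q *
        ((k.choose j : ℝ) * (j.factorial : ℝ) * ((k - j).factorial : ℝ)) := by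
        rw [hexp, hfac, hpow, mul_pow (σX * σY) (1 + ρ), mul_pow (σX * σY) (ρ - 1)]
        ring
    _ = (σX * σY) ^ k * rexp (-(x + y) / 2) / Real.Gamma ((n : ℝ) / 2) ^ 2 *
        ((k.choose j : ℝ) * (1 + ρ) ^ j * (ρ - 1) ^ (k - j) *
        (Real.Gamma ((n : ℝ) / 2) * rexp (x / 2) * (j.factorial : ℝ) * P) *
        (Real.Gamma ((n : ℝ) / 2) * rexp (y / 2) * ((k - j).factorial : ℝ) * Q)) := by
        field_simp
    _ = _ := by
        rw [← e1, ← e2]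
        ring

end
end

section
/- Let μ_X, μ_Y ∈ ℝ, σ_X, σ_Y > 0, ρ ∈ (−1,1) and n ≥ 1 an integer. Then P(S_n ≤ 0) = e^{−(λ₊+λ₋)/2} Σ_{j=0}^∞ Σ_{k=0}^∞ (1/(j! k!)) (λ₊/2)^j (λ₋/2)^k I_{(1−ρ)/2}(n/2 + j, n/2 + k), where I_x(a,b) is the regularized incomplete beta function. -/
open MeasureTheory ProbabilityTheory Real

noncomputable section

/-- The regularized incomplete beta function
`I_x(a,b) = (∫₀^x t^{a-1} (1-t)^{b-1} dt) / (∫₀^1 t^{a-1} (1-t)^{b-1} dt)`. -/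
def regIncBeta (x a b : ℝ) : ℝ :=
  (∫ t in (0 : ℝ)..x, t ^ (a - 1) * (1 - t) ^ (b - 1)) /
    ∫ t in (0 : ℝ)..1, t ^ (a - 1) * (1 - t) ^ (b - 1)

/-- Finite measures on `ℝ` whose moment generating functions are finite and agree near `0` are
equal. -/
lemma Measure.ext_of_lintegral_exp_mul {μ ν : Measure ℝ} [IsFiniteMeasure μ] [IsFiniteMeasure ν]
    {δ : ℝ} (hδ : 0 < δ)
    (hμ : ∀ t : ℝ, |t| < δ → ∫⁻ x, ENNReal.ofReal (exp (t * x)) ∂μ ≠ ⊤)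
    (h : ∀ t : ℝ, |t| < δ →
      ∫⁻ x, ENNReal.ofReal (exp (t * x)) ∂μ = ∫⁻ x, ENNReal.ofReal (exp (t * x)) ∂ν) :
    μ = ν := by
  have integrable_iff (ρ : Measure ℝ) (t : ℝ) :
      Integrable (fun x : ℝ => exp (t * x)) ρ ↔ ∫⁻ x, ENNReal.ofReal (exp (t * x)) ∂ρ ≠ ⊤ := by
    rw [← lintegral_ofReal_ne_top_iff_integrable (by fun_prop)
      (Filter.Eventually.of_forall fun x => (exp_pos _).le)]
  have subset_interior (ρ : Measure ℝ)
      (hρ : ∀ t : ℝ, |t| < δ → ∫⁻ x, ENNReal.ofReal (exp (t * x)) ∂ρ ≠ ⊤) :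
      Set.Ioo (-δ) δ ⊆ interior (integrableExpSet id ρ) :=
    interior_maximal (fun t ht => (integrable_iff ρ t).2 (hρ t (abs_lt.2 ht))) isOpen_Ioo
  have hν : ∀ t : ℝ, |t| < δ → ∫⁻ x, ENNReal.ofReal (exp (t * x)) ∂ν ≠ ⊤ :=
    fun t ht => h t ht ▸ hμ t ht
  have mgf_eq (t : ℝ) (ht : |t| < δ) : mgf id μ t = mgf id ν t := by
    simp only [mgf, id]
    rw [integral_eq_lintegral_of_nonneg_ae (Filter.Eventually.of_forall fun x => (exp_pos _).le)
        (by fun_prop), integral_eq_lintegral_of_nonneg_ae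
        (Filter.Eventually.of_forall fun x => (exp_pos _).le) (by fun_prop), h t ht]
  let U : Set ℂ := {z | z.re ∈ Set.Ioo (-δ) δ}
  have hU : IsPreconnected U :=
    ((convex_Ioo (-δ) δ).linear_preimage Complex.reLm).isPreconnected
  have hEq : Set.EqOn (complexMGF id μ) (complexMGF id ν) U := by
    refine AnalyticOnNhd.eqOn_of_preconnected_of_frequently_eq
      (fun z hz => analyticAt_complexMGF (subset_interior μ hμ hz))
      (fun z hz => analyticAt_complexMGF (subset_interior ν hν hz)) hU (z₀ := 0)
      (by simp [U, hδ]) ?_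
    have hlim : Filter.Tendsto (fun x : ℝ => (x : ℂ)) (nhdsWithin 0 {0}ᶜ)
        (nhdsWithin 0 {0}ᶜ) := by
      refine tendsto_nhdsWithin_of_tendsto_nhds_of_eventually_within _ ?_ ?_
      · exact (Complex.continuous_ofReal.tendsto' 0 0 (by simp)).mono_left nhdsWithin_le_nhds
      · filter_upwards [self_mem_nhdsWithin] with x hx
        simpa using hx
    refine hlim.frequently (Filter.Eventually.frequently ?_)
    have : ∀ᶠ x : ℝ in nhdsWithin 0 {0}ᶜ, x ∈ Set.Ioo (-δ) δ :=
      nhdsWithin_le_nhds (Ioo_mem_nhds (by linarith) hδ)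
    filter_upwards [this] with x hx
    rw [complexMGF_ofReal, complexMGF_ofReal, mgf_eq x (abs_lt.2 hx)]
  refine Measure.ext_of_charFun (funext fun t => ?_)
  rw [← complexMGF_id_mul_I, ← complexMGF_id_mul_I]
  exact hEq (by simp [U, hδ])

lemma lintegral_exp_mul_gammaMeasure {a r t : ℝ} (ha : 0 < a) (hr : 0 < r) (ht : t < r) :
    ∫⁻ x, ENNReal.ofReal (exp (t * x)) ∂gammaMeasure a r = ENNReal.ofReal ((r / (r - t)) ^ a) := by
  have hrt : 0 < r - t := sub_pos.2 ht
  rw [gammaMeasure, lintegral_withDensity_eq_lintegral_mul _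
    (show Measurable (gammaPDF a r) from (measurable_gammaPDFReal a r).ennreal_ofReal)
    (by fun_prop)]
  have key (x : ℝ) : gammaPDF a r x * ENNReal.ofReal (exp (t * x)) =
      ENNReal.ofReal ((r / (r - t)) ^ a) * gammaPDF a (r - t) x := by
    rw [gammaPDF, gammaPDF, ← ENNReal.ofReal_mul (gammaPDFReal_nonneg ha hr x),
      ← ENNReal.ofReal_mul (by positivity)]
    congr 1
    unfold gammaPDFReal
    split_ifs with hx
    · have : exp (-((r - t) * x)) = exp (-(r * x)) * exp (t * x) := by
        rw [← exp_add]; ring_nf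
      rw [this, div_rpow hr.le hrt.le]
      field_simp
    · simp
  simp only [Pi.mul_apply, key]
  rw [lintegral_const_mul _
    (show Measurable (gammaPDF a (r - t)) from (measurable_gammaPDFReal a _).ennreal_ofReal),
    lintegral_gammaPDF_eq_one ha hrt, mul_one]

lemma lintegral_exp_mul_sq_gaussianReal (m : ℝ) {t : ℝ} (ht : t < 1 / 2) :
    ∫⁻ x, ENNReal.ofReal (exp (t * (m + x) ^ 2)) ∂gaussianReal 0 1 =
      ENNReal.ofReal ((√(1 - 2 * t))⁻¹ * exp (t * m ^ 2 / (1 - 2 * t))) := by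
  have hs : 0 < 1 - 2 * t := by linarith
  let v : NNReal := ⟨(1 - 2 * t)⁻¹, by positivity⟩
  have hv : v ≠ 0 := fun h => (inv_pos.2 hs).ne' (congrArg NNReal.toReal h)
  rw [gaussianReal_of_var_ne_zero _ one_ne_zero, lintegral_withDensity_eq_lintegral_mul _
    (measurable_gaussianPDF _ _) (by fun_prop)]
  have key (x : ℝ) : gaussianPDF 0 1 x * ENNReal.ofReal (exp (t * (m + x) ^ 2)) =
      ENNReal.ofReal ((√(1 - 2 * t))⁻¹ * exp (t * m ^ 2 / (1 - 2 * t))) *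
        gaussianPDF (2 * t * m / (1 - 2 * t)) v x := by
    rw [gaussianPDF, gaussianPDF, ← ENNReal.ofReal_mul (gaussianPDFReal_nonneg _ _ _),
      ← ENNReal.ofReal_mul (by positivity)]
    congr 1
    have hvc : (v : ℝ) = (1 - 2 * t)⁻¹ := rfl
    rw [gaussianPDFReal, gaussianPDFReal, hvc, NNReal.coe_one, mul_one (2 * π),
      sqrt_mul (by positivity) (1 - 2 * t)⁻¹, sqrt_inv]
    have hexp : exp (t * m ^ 2 / (1 - 2 * t)) *
        exp (-(x - 2 * t * m / (1 - 2 * t)) ^ 2 / (2 * (1 - 2 * t)⁻¹)) =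
        exp (-(x - 0) ^ 2 / (2 * 1)) * exp (t * (m + x) ^ 2) := by
      rw [← exp_add, ← exp_add]
      congr 1
      obtain ⟨s, rfl⟩ : ∃ s, t = (1 - s) / 2 := ⟨1 - 2 * t, by ring⟩
      rw [show 1 - 2 * ((1 - s) / 2) = s by ring] at hs ⊢
      field_simp
      ring
    have hsq : √(1 - 2 * t) ≠ 0 := (sqrt_pos.2 hs).ne'
    rw [mul_inv, inv_inv]
    calc _ = (√(2 * π))⁻¹ * (exp (-(x - 0) ^ 2 / (2 * 1)) * exp (t * (m + x) ^ 2)) := by ring_nf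
      _ = _ := by rw [← hexp]; field_simp
  simp only [Pi.mul_apply, key]
  rw [lintegral_const_mul _ (measurable_gaussianPDF _ _), lintegral_gaussianPDF_eq_one _ hv,
    mul_one]

/-- The Poisson mixture `∑ⱼ e^{-lam/2} (lam/2)^j / j! • Γ(r/2 + j, 1/2)` of Gamma distributions
which represents the noncentral chi-square distribution. -/
def ncChiSqMixture (r lam : ℝ) : Measure ℝ :=
  Measure.sum fun j : ℕ =>
    ENNReal.ofReal (exp (-lam / 2) * ((lam / 2) ^ j / j.factorial)) •
      gammaMeasure (r / 2 + j) (1 / 2)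

lemma lintegral_exp_mul_ncChiSqMixture {r lam t : ℝ} (hr : 0 < r) (hlam : 0 ≤ lam)
    (ht : t < 1 / 2) :
    ∫⁻ x, ENNReal.ofReal (exp (t * x)) ∂ncChiSqMixture r lam =
      ENNReal.ofReal ((1 - 2 * t)⁻¹ ^ (r / 2) * exp (lam * t / (1 - 2 * t))) := by
  have hs : 0 < 1 - 2 * t := by linarith
  have hq : (1 / 2 : ℝ) / (1 / 2 - t) = (1 - 2 * t)⁻¹ := by
    have : (1 / 2 - t : ℝ) ≠ 0 := by linarith
    field_simp
  set q : ℝ := (1 - 2 * t)⁻¹ with hqdef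
  have hq0 : 0 < q := inv_pos.2 hs
  have hsum : HasSum (fun j : ℕ =>
      exp (-lam / 2) * ((lam / 2) ^ j / j.factorial) * q ^ (r / 2 + j))
      (q ^ (r / 2) * exp (lam * t / (1 - 2 * t))) := by
    have h := (NormedSpace.expSeries_div_hasSum_exp (lam / 2 * q)).mul_left
      (exp (-lam / 2) * q ^ (r / 2))
    rw [← Real.exp_eq_exp_ℝ] at h
    convert! h using 1
    · ext j
      rw [rpow_add hq0, rpow_natCast, mul_pow]
      ring
    · rw [mul_right_comm, ← exp_add, mul_comm]
      congr 2
      rw [hqdef]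
      clear_value q
      obtain ⟨s, rfl⟩ : ∃ s, t = (1 - s) / 2 := ⟨1 - 2 * t, by ring⟩
      rw [show 1 - 2 * ((1 - s) / 2) = s by ring] at hs ⊢
      field_simp
      ring
  rw [ncChiSqMixture, lintegral_sum_measure, ← hsum.tsum_eq,
    ENNReal.ofReal_tsum_of_nonneg (fun j => by positivity) hsum.summable]
  congr 1 with j
  rw [lintegral_smul_measure, lintegral_exp_mul_gammaMeasure (by positivity) (by norm_num) ht, hq,
    smul_eq_mul, ← ENNReal.ofReal_mul (by positivity)]

lemma isProbabilityMeasure_ncChiSqMixture {r lam : ℝ} (hr : 0 < r) (hlam : 0 ≤ lam) :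
    IsProbabilityMeasure (ncChiSqMixture r lam) where
  measure_univ := by
    simpa using lintegral_exp_mul_ncChiSqMixture (t := 0) hr hlam (by norm_num)

lemma lintegral_exp_mul_sq_gaussianReal_pow (m : ℝ) {n : ℕ} (hn : 1 ≤ n) {t : ℝ}
    (ht : t < 1 / 2) :
    (∫⁻ x, ENNReal.ofReal (exp (t * (m + x) ^ 2)) ∂gaussianReal 0 1) ^ n =
      ∫⁻ x, ENNReal.ofReal (exp (t * x)) ∂ncChiSqMixture n (n * m ^ 2) := by
  have hs : 0 < 1 - 2 * t := by linarith
  rw [lintegral_exp_mul_sq_gaussianReal m ht, lintegral_exp_mul_ncChiSqMixture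
    (by exact_mod_cast hn) (by positivity) ht, ← ENNReal.ofReal_pow (by positivity), mul_pow,
    ← exp_nat_mul, ← sqrt_inv, rpow_div_two_eq_sqrt _ (by positivity), rpow_natCast]
  congr 3
  ring

instance (μX μY σX σY ρ : ℝ) : IsProbabilityMeasure (binormal μX μY σX σY ρ) :=
  Measure.isProbabilityMeasure_map (by fun_prop)

instance (μX μY σX σY ρ : ℝ) : IsProbabilityMeasure (prodNormal μX μY σX σY ρ) :=
  Measure.isProbabilityMeasure_map (by fun_prop)

instance (n : ℕ) (μX μY σX σY ρ : ℝ) : IsProbabilityMeasure (sumProdNormal n μX μY σX σY ρ) :=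
  Measure.isProbabilityMeasure_map (by fun_prop)

lemma lintegral_exp_mul_prodNormal (μX μY : ℝ) {σX σY ρ : ℝ} (hσX : 0 < σX) (hσY : 0 < σY)
    (hρ : ρ ∈ Set.Ioo (-1 : ℝ) 1) (t : ℝ) :
    ∫⁻ z, ENNReal.ofReal (exp (t * z)) ∂prodNormal μX μY σX σY ρ =
      (∫⁻ x, ENNReal.ofReal (exp (t * (σX * σY * (1 + ρ) / 2) *
          ((μX / σX + μY / σY) / √(2 * (1 + ρ)) + x) ^ 2)) ∂gaussianReal 0 1) *
      ∫⁻ x, ENNReal.ofReal (exp (-(t * (σX * σY * (1 - ρ) / 2)) *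
          (-((μX / σX - μY / σY) / √(2 * (1 - ρ))) + x) ^ 2)) ∂gaussianReal 0 1 := by
  obtain ⟨hρ1, hρ2⟩ := hρ
  set C := √((1 + ρ) / 2) with hC
  set S := √((1 - ρ) / 2) with hS
  have hC0 : 0 < C := sqrt_pos.2 (by linarith)
  have hS0 : 0 < S := sqrt_pos.2 (by linarith)
  have hC2 : C ^ 2 = (1 + ρ) / 2 := sq_sqrt (by linarith)
  have hS2 : S ^ 2 = (1 - ρ) / 2 := sq_sqrt (by linarith)
  have h2C : √(2 * (1 + ρ)) = 2 * C := by
    rw [show 2 * (1 + ρ) = (2 * C) ^ 2 by rw [mul_pow, hC2]; ring, sqrt_sq (by positivity)]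
  have h2S : √(2 * (1 - ρ)) = 2 * S := by
    rw [show 2 * (1 - ρ) = (2 * S) ^ 2 by rw [mul_pow, hS2]; ring, sqrt_sq (by positivity)]
  have hCS : √(1 - ρ ^ 2) = 2 * C * S := by
    rw [show 1 - ρ ^ 2 = (2 * C * S) ^ 2 by rw [mul_pow, mul_pow, hC2, hS2]; ring,
      sqrt_sq (by positivity)]
  have hcos : cos (arccos C) = C :=
    cos_arccos (by linarith) (sqrt_le_one.2 (by linarith))
  have hsin : sin (arccos C) = S := by
    rw [sin_arccos, hC2, hS]
    congr 1
    ring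
  have hrot := IsGaussian.map_rotation_eq_self (μ := gaussianReal 0 1) (by simp) (arccos C)
  rw [prodNormal, lintegral_map (by fun_prop) (by fun_prop), binormal,
    lintegral_map (by fun_prop) (by fun_prop), h2C, h2S,
    ← lintegral_prod_mul (by fun_prop) (by fun_prop)]
  conv_rhs => rw [← hrot]
  rw [lintegral_map (by fun_prop) (by fun_prop)]
  congr 1 with p
  rw [ContinuousLinearMap.rotation_apply, hcos, hsin, ← ENNReal.ofReal_mul (exp_pos _).le,
    ← exp_add, hCS]
  congr 2
  have h1 : 1 + ρ = 2 * C ^ 2 := by rw [hC2]; ring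
  have h2 : 1 - ρ = 2 * S ^ 2 := by rw [hS2]; ring
  have h3 : ρ = C ^ 2 - S ^ 2 := by rw [hC2, hS2]; ring
  rw [h1, h2]
  simp only [smul_eq_mul]
  rw [h3]
  have h4 : C ^ 2 + S ^ 2 = 1 := by rw [hC2, hS2]; ring
  field_simp
  linear_combination -(4 * t * σX ^ 2 * σY * p.1 * μY + 8 * t * σX ^ 2 * p.1 * σY ^ 2 * C * S * p.2
    + 4 * t * σX ^ 2 * p.1 ^ 2 * σY ^ 2 * (C ^ 2 - S ^ 2)) * h4

lemma lintegral_exp_mul_sumProdNormal (n : ℕ) (μX μY σX σY ρ t : ℝ) :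
    ∫⁻ z, ENNReal.ofReal (exp (t * z)) ∂sumProdNormal n μX μY σX σY ρ =
      (∫⁻ z, ENNReal.ofReal (exp (t * z)) ∂prodNormal μX μY σX σY ρ) ^ n := by
  rw [sumProdNormal, lintegral_map (by fun_prop) (by fun_prop)]
  simp_rw [Finset.mul_sum, exp_sum, ENNReal.ofReal_prod_of_nonneg fun _ _ => (exp_pos _).le]
  rw [lintegral_prod_eq_prod_lintegral_of_indepFun Finset.univ
    (fun (i : Fin n) (x : Fin n → ℝ) => ENNReal.ofReal (exp (t * x i)))
    (iIndepFun_pi (X := fun (_ : Fin n) (z : ℝ) => ENNReal.ofReal (exp (t * z)))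
      fun _ => by fun_prop) fun _ => by fun_prop]
  have heval (i : Fin n) : ∫⁻ x : Fin n → ℝ, ENNReal.ofReal (exp (t * x i))
      ∂Measure.pi (fun _ => prodNormal μX μY σX σY ρ) =
      ∫⁻ z, ENNReal.ofReal (exp (t * z)) ∂prodNormal μX μY σX σY ρ :=
    (measurePreserving_eval (fun _ : Fin n => prodNormal μX μY σX σY ρ) i).lintegral_comp
      (f := fun z : ℝ => ENNReal.ofReal (exp (t * z))) (by fun_prop)
  simp [heval]

lemma sumProdNormal_eq_map_sub (μX μY : ℝ) {σX σY ρ : ℝ} (hσX : 0 < σX) (hσY : 0 < σY)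
    (hρ : ρ ∈ Set.Ioo (-1 : ℝ) 1) {n : ℕ} (hn : 1 ≤ n) :
    sumProdNormal n μX μY σX σY ρ =
      Measure.map (fun p : ℝ × ℝ => σX * σY * (1 + ρ) / 2 * p.1 - σX * σY * (1 - ρ) / 2 * p.2)
        ((ncChiSqMixture n ((n : ℝ) / (2 * (1 + ρ)) * (μX / σX + μY / σY) ^ 2)).prod
          (ncChiSqMixture n ((n : ℝ) / (2 * (1 - ρ)) * (μX / σX - μY / σY) ^ 2))) := by
  have hρ1 : 0 < 1 + ρ := by linarith [hρ.1]
  have hρ2 : 0 < 1 - ρ := by linarith [hρ.2]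
  have hn0 : (0 : ℝ) < n := by exact_mod_cast hn
  set c₁ := σX * σY * (1 + ρ) / 2 with hc₁
  set c₂ := σX * σY * (1 - ρ) / 2 with hc₂
  have hc₁0 : 0 < c₁ := by positivity
  have hc₂0 : 0 < c₂ := by positivity
  have hlam₁ : (n : ℝ) / (2 * (1 + ρ)) * (μX / σX + μY / σY) ^ 2 =
      n * ((μX / σX + μY / σY) / √(2 * (1 + ρ))) ^ 2 := by
    rw [div_pow, sq_sqrt (by positivity)]; ring
  have hlam₂ : (n : ℝ) / (2 * (1 - ρ)) * (μX / σX - μY / σY) ^ 2 =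
      n * (-((μX / σX - μY / σY) / √(2 * (1 - ρ)))) ^ 2 := by
    rw [neg_sq, div_pow, sq_sqrt (by positivity)]; ring
  rw [hlam₁, hlam₂]
  set m₁ := (μX / σX + μY / σY) / √(2 * (1 + ρ))
  set m₂ := -((μX / σX - μY / σY) / √(2 * (1 - ρ)))
  have := isProbabilityMeasure_ncChiSqMixture hn0 (show 0 ≤ n * m₁ ^ 2 by positivity)
  have := isProbabilityMeasure_ncChiSqMixture hn0 (show 0 ≤ n * m₂ ^ 2 by positivity)
  have : IsProbabilityMeasure (Measure.map (fun p : ℝ × ℝ => c₁ * p.1 - c₂ * p.2)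
      ((ncChiSqMixture n (n * m₁ ^ 2)).prod (ncChiSqMixture n (n * m₂ ^ 2)))) :=
    Measure.isProbabilityMeasure_map (by fun_prop)
  have small (t : ℝ) (ht : |t| < 1 / (2 * (c₁ + c₂))) : t * c₁ < 1 / 2 ∧ -(t * c₂) < 1 / 2 := by
    rw [lt_div_iff₀ (by positivity)] at ht
    have h1 : t * c₁ ≤ |t| * c₁ := by gcongr; exact le_abs_self t
    have h2 : -t * c₂ ≤ |t| * c₂ := by gcongr; exact neg_le_abs t
    have h3 : 0 ≤ |t| * c₁ := by positivity
    have h4 : 0 ≤ |t| * c₂ := by positivity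
    constructor <;> linarith
  refine Measure.ext_of_lintegral_exp_mul (δ := 1 / (2 * (c₁ + c₂))) (by positivity)
    (fun t ht => ?_) (fun t ht => ?_)
  · rw [lintegral_exp_mul_sumProdNormal, lintegral_exp_mul_prodNormal μX μY hσX hσY hρ, mul_pow,
      lintegral_exp_mul_sq_gaussianReal _ (small t ht).1,
      lintegral_exp_mul_sq_gaussianReal _ (small t ht).2]
    exact ENNReal.mul_ne_top (ENNReal.pow_ne_top ENNReal.ofReal_ne_top)
      (ENNReal.pow_ne_top ENNReal.ofReal_ne_top)
  · rw [lintegral_exp_mul_sumProdNormal, lintegral_exp_mul_prodNormal μX μY hσX hσY hρ, mul_pow,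
      lintegral_exp_mul_sq_gaussianReal_pow _ hn (small t ht).1,
      lintegral_exp_mul_sq_gaussianReal_pow _ hn (small t ht).2,
      lintegral_map (by fun_prop) (by fun_prop),
      ← lintegral_prod_mul (by fun_prop) (by fun_prop)]
    congr 1 with p
    rw [← ENNReal.ofReal_mul (exp_pos _).le, ← exp_add]
    congr 2
    ring

/-- Change of variables `x = s t`, `y = s (1 - t)`. -/
lemma lintegral_lintegral_eq_lintegral_mul_one_sub {f : ℝ → ℝ → ENNReal}
    (hf : Measurable (Function.uncurry f)) :
    ∫⁻ x, ∫⁻ y, f x y = ∫⁻ s, ENNReal.ofReal |s| * ∫⁻ t, f (s * t) (s * (1 - t)) := by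
  calc ∫⁻ x, ∫⁻ y, f x y = ∫⁻ x, ∫⁻ s, f x (s - x) := by
        congr 1 with x
        exact (lintegral_sub_right_eq_self (fun y => f x y) x).symm
    _ = ∫⁻ s, ∫⁻ x, f x (s - x) :=
        lintegral_lintegral_swap
          (hf.comp (measurable_fst.prodMk (measurable_snd.sub measurable_fst))).aemeasurable
    _ = _ := by
        refine lintegral_congr_ae ?_
        filter_upwards [Measure.ae_ne volume 0] with s hs
        have hfs : Measurable fun x => f x (s - x) :=
          hf.comp (measurable_id.prodMk (measurable_const.sub measurable_id))
        nth_rewrite 1 [← smul_map_volume_mul_left hs]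
        rw [lintegral_smul_measure, lintegral_map hfs (by fun_prop), smul_eq_mul]
        simp only [mul_sub, mul_one]

/-- A set described in terms of `x / (x + y)` has, under the product of two Gamma distributions
with the same rate, a measure proportional to a beta integral. -/
lemma gammaMeasure_prod_apply_of_cone {a b r : ℝ} (ha : 0 < a) (hb : 0 < b) (hr : 0 < r) :
    ∃ K : ENNReal, ∀ (S : Set (ℝ × ℝ)) (A : Set ℝ), MeasurableSet S → MeasurableSet A →
      (∀ s t : ℝ, 0 < s → ((s * t, s * (1 - t)) ∈ S ↔ t ∈ A)) →
      ((gammaMeasure a r).prod (gammaMeasure b r)) S =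
        K * ∫⁻ t in A ∩ Set.Icc 0 1, ENNReal.ofReal (t ^ (a - 1) * (1 - t) ^ (b - 1)) := by
  have hma : Measurable (gammaPDF a r) := (measurable_gammaPDFReal a r).ennreal_ofReal
  have hmb : Measurable (gammaPDF b r) := (measurable_gammaPDFReal b r).ennreal_ofReal
  have hΓa := Gamma_pos_of_pos ha
  have hΓb := Gamma_pos_of_pos hb
  refine ⟨∫⁻ s in Set.Ioi (0 : ℝ), ENNReal.ofReal (s * (r ^ a / Gamma a * (r ^ b / Gamma b) *
    (s ^ (a - 1) * s ^ (b - 1)) * exp (-(r * s)))), fun S A hS hA hSA => ?_⟩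
  have hmeas : Measurable fun z : ℝ × ℝ =>
      S.indicator (fun z => gammaPDF a r z.1 * gammaPDF b r z.2) z :=
    ((hma.comp measurable_fst).mul (hmb.comp measurable_snd)).indicator hS
  have hAI : MeasurableSet (A ∩ Set.Icc (0 : ℝ) 1) := hA.inter measurableSet_Icc
  have pdf_mul {s : ℝ} (hs : 0 < s) (t : ℝ) :
      ENNReal.ofReal s *
        S.indicator (fun z => gammaPDF a r z.1 * gammaPDF b r z.2) (s * t, s * (1 - t)) =
      ENNReal.ofReal (s * (r ^ a / Gamma a * (r ^ b / Gamma b) *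
        (s ^ (a - 1) * s ^ (b - 1)) * exp (-(r * s)))) *
      (A ∩ Set.Icc 0 1).indicator
        (fun t => ENNReal.ofReal (t ^ (a - 1) * (1 - t) ^ (b - 1))) t := by
    by_cases htA : t ∈ A
    swap
    · rw [Set.indicator_of_notMem (fun h => htA ((hSA s t hs).1 h)),
        Set.indicator_of_notMem (fun h => htA h.1), mul_zero, mul_zero]
    rw [Set.indicator_of_mem ((hSA s t hs).2 htA)]
    rcases lt_or_ge t 0 with h0 | h0
    · rw [Set.indicator_of_notMem (fun h => h0.not_ge h.2.1),
        gammaPDF_of_neg (mul_neg_of_pos_of_neg hs h0)]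
      simp
    rcases lt_or_ge 1 t with h1 | h1
    · rw [Set.indicator_of_notMem (fun h => h1.not_ge h.2.2),
        gammaPDF_of_neg (x := s * (1 - t)) (mul_neg_of_pos_of_neg hs (by linarith))]
      simp
    have h1' : 0 ≤ 1 - t := by linarith
    rw [Set.indicator_of_mem (show t ∈ A ∩ Set.Icc 0 1 from ⟨htA, h0, h1⟩),
      gammaPDF_of_nonneg (by positivity),
      gammaPDF_of_nonneg (by positivity), ← ENNReal.ofReal_mul (by positivity),
      ← ENNReal.ofReal_mul (by positivity), ← ENNReal.ofReal_mul (by positivity),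
      mul_rpow hs.le h0, mul_rpow hs.le h1',
      show exp (-(r * s)) = exp (-(r * (s * t))) * exp (-(r * (s * (1 - t)))) by
        rw [← exp_add]; ring_nf]
    congr 1
    ring
  have pdf_mul_nonpos {s : ℝ} (hs : s ≤ 0) (t : ℝ) :
      ENNReal.ofReal |s| *
        S.indicator (fun z => gammaPDF a r z.1 * gammaPDF b r z.2) (s * t, s * (1 - t)) = 0 := by
    rcases hs.eq_or_lt with rfl | hs
    · simp
    by_cases hmem : (s * t, s * (1 - t)) ∈ S
    swap
    · rw [Set.indicator_of_notMem hmem, mul_zero]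
    rw [Set.indicator_of_mem hmem]
    rcases lt_or_ge 0 t with h0 | h0
    · rw [gammaPDF_of_neg (mul_neg_of_neg_of_pos hs h0)]
      simp
    · rw [gammaPDF_of_neg (x := s * (1 - t)) (mul_neg_of_neg_of_pos hs (by linarith))]
      simp
  rw [gammaMeasure, gammaMeasure, prod_withDensity hma hmb, withDensity_apply _ hS,
    ← lintegral_indicator hS, lintegral_prod _ hmeas.aemeasurable,
    lintegral_lintegral_eq_lintegral_mul_one_sub
      (f := fun x y => S.indicator (fun z => gammaPDF a r z.1 * gammaPDF b r z.2) (x, y)) hmeas,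
    ← lintegral_indicator hAI, ← lintegral_mul_const'' _ (by fun_prop),
    ← lintegral_indicator measurableSet_Ioi]
  congr 1 with s
  have hms : Measurable fun t : ℝ =>
      S.indicator (fun z => gammaPDF a r z.1 * gammaPDF b r z.2) (s * t, s * (1 - t)) :=
    hmeas.comp (by fun_prop)
  have hmt : Measurable ((A ∩ Set.Icc 0 1).indicator
      fun t : ℝ => ENNReal.ofReal (t ^ (a - 1) * (1 - t) ^ (b - 1))) :=
    Measurable.indicator (by fun_prop) hAI
  rw [← lintegral_const_mul _ hms]
  rcases le_or_gt s 0 with hs | hs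
  · rw [Set.indicator_of_notMem (by simpa using hs)]
    simp [pdf_mul_nonpos hs]
  · rw [Set.indicator_of_mem (by simpa using hs), ← lintegral_const_mul _ hmt, abs_of_pos hs]
    simp only [pdf_mul hs]

lemma intervalIntegral_beta_eq_toReal_lintegral (a b : ℝ) {x : ℝ} (hx0 : 0 ≤ x) (hx1 : x ≤ 1) :
    ∫ t in (0 : ℝ)..x, t ^ (a - 1) * (1 - t) ^ (b - 1) =
      (∫⁻ t in Set.Icc 0 x, ENNReal.ofReal (t ^ (a - 1) * (1 - t) ^ (b - 1))).toReal := by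
  rw [intervalIntegral.integral_of_le hx0, ← integral_Icc_eq_integral_Ioc,
    integral_eq_lintegral_of_nonneg_ae]
  · filter_upwards [ae_restrict_mem measurableSet_Icc] with t ht
    have h0 : 0 ≤ t := ht.1
    have h1 : 0 ≤ 1 - t := by linarith [ht.2]
    simp only [Pi.zero_apply]
    positivity
  · exact Measurable.aestronglyMeasurable (by fun_prop)

lemma toReal_gammaMeasure_prod_eq_regIncBeta {a b r p : ℝ} (ha : 0 < a) (hb : 0 < b) (hr : 0 < r)
    (hp0 : 0 ≤ p) (hp1 : p ≤ 1) :
    (((gammaMeasure a r).prod (gammaMeasure b r))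
      {z | (1 - p) * z.1 ≤ p * z.2}).toReal = regIncBeta p a b := by
  have := isProbabilityMeasure_gammaMeasure ha hr
  have := isProbabilityMeasure_gammaMeasure hb hr
  obtain ⟨K, hK⟩ := gammaMeasure_prod_apply_of_cone ha hb hr
  have huniv := hK Set.univ Set.univ .univ .univ (by simp)
  have hcone := hK {z | (1 - p) * z.1 ≤ p * z.2} (Set.Iic p)
    (measurableSet_le (by fun_prop) (by fun_prop)) measurableSet_Iic fun s t hs => by
      rw [Set.mem_ofPred_eq, Set.mem_Iic, ← mul_le_mul_iff_right₀ (b := t) hs]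
      constructor <;> intro h <;> linarith
  have hinter : Set.Iic p ∩ Set.Icc 0 1 = Set.Icc 0 p := by
    ext t
    simp only [Set.mem_inter_iff, Set.mem_Iic, Set.mem_Icc]
    grind
  rw [measure_univ, Set.univ_inter] at huniv
  have huniv' := congrArg ENNReal.toReal huniv
  rw [ENNReal.toReal_one, ENNReal.toReal_mul] at huniv'
  rw [hcone, hinter, ENNReal.toReal_mul, regIncBeta,
    intervalIntegral_beta_eq_toReal_lintegral a b hp0 hp1,
    intervalIntegral_beta_eq_toReal_lintegral a b zero_le_one le_rfl,
    eq_div_iff (right_ne_zero_of_mul (huniv' ▸ one_ne_zero))]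
  linear_combination
    -(∫⁻ t in Set.Icc 0 p, ENNReal.ofReal (t ^ (a - 1) * (1 - t) ^ (b - 1))).toReal * huniv'

lemma sum_smul_prod_sum_smul_apply {α β : Type*} [MeasurableSpace α] [MeasurableSpace β]
    (v w : ℕ → ENNReal) (μ : ℕ → Measure α) (ν : ℕ → Measure β) [∀ k, SFinite (ν k)]
    {S : Set (α × β)} (hS : MeasurableSet S) :
    ((Measure.sum fun j => v j • μ j).prod (Measure.sum fun k => w k • ν k)) S =
      ∑' j, ∑' k, v j * w k * ((μ j).prod (ν k)) S := by
  rw [Measure.prod_apply hS, lintegral_sum_measure]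
  congr 1 with j
  simp_rw [lintegral_smul_measure, Measure.sum_apply _ (measurable_prodMk_left hS),
    Measure.smul_apply, smul_eq_mul]
  rw [lintegral_tsum fun k => ((measurable_measure_prodMk_left hS).const_mul _).aemeasurable,
    ← ENNReal.tsum_mul_left]
  congr 1 with k
  rw [lintegral_const_mul _ (measurable_measure_prodMk_left hS), ← Measure.prod_apply hS,
    mul_assoc]

lemma toReal_ncChiSqMixture_prod {r lam₁ lam₂ p : ℝ} (hr : 0 < r) (h₁ : 0 ≤ lam₁)
    (h₂ : 0 ≤ lam₂) (hp0 : 0 ≤ p) (hp1 : p ≤ 1) :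
    (((ncChiSqMixture r lam₁).prod (ncChiSqMixture r lam₂))
      {z | (1 - p) * z.1 ≤ p * z.2}).toReal =
      exp (-(lam₁ + lam₂) / 2) * ∑' j : ℕ, ∑' k : ℕ,
        1 / ((j.factorial : ℝ) * (k.factorial : ℝ)) * (lam₁ / 2) ^ j * (lam₂ / 2) ^ k *
          regIncBeta p (r / 2 + j) (r / 2 + k) := by
  have := isProbabilityMeasure_ncChiSqMixture hr h₁
  have := isProbabilityMeasure_ncChiSqMixture hr h₂
  have (k : ℕ) : IsProbabilityMeasure (gammaMeasure (r / 2 + k) (1 / 2)) :=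
    isProbabilityMeasure_gammaMeasure (by positivity) (by norm_num)
  have hS : MeasurableSet {z : ℝ × ℝ | (1 - p) * z.1 ≤ p * z.2} :=
    measurableSet_le (by fun_prop) (by fun_prop)
  have hsum := measure_ne_top ((ncChiSqMixture r lam₁).prod (ncChiSqMixture r lam₂))
    {z | (1 - p) * z.1 ≤ p * z.2}
  rw [ncChiSqMixture, ncChiSqMixture, sum_smul_prod_sum_smul_apply _ _ _ _ hS] at hsum ⊢
  have hsum' := ENNReal.ne_top_of_tsum_ne_top hsum
  rw [ENNReal.tsum_toReal_eq hsum', ← tsum_mul_left]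
  congr 1 with j
  rw [ENNReal.tsum_toReal_eq (ENNReal.ne_top_of_tsum_ne_top (hsum' j)), ← tsum_mul_left]
  congr 1 with k
  rw [ENNReal.toReal_mul, ENNReal.toReal_mul, ENNReal.toReal_ofReal (by positivity),
    ENNReal.toReal_ofReal (by positivity),
    toReal_gammaMeasure_prod_eq_regIncBeta (by positivity) (by positivity) (by norm_num) hp0 hp1,
    show -(lam₁ + lam₂) / 2 = -lam₁ / 2 + -lam₂ / 2 by ring, exp_add]
  field_simp

/-- Let `μX, μY ∈ ℝ`, `σX, σY > 0`, `ρ ∈ (-1,1)` and `n ≥ 1`. Then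
`P(Sₙ ≤ 0) = e^{-(λ₊+λ₋)/2} ∑_{j=0}^∞ ∑_{k=0}^∞ (1/(j! k!)) (λ₊/2)^j (λ₋/2)^k
I_{(1-ρ)/2}(n/2 + j, n/2 + k)`, where `λ₊ = (n/(2(1+ρ)))(μX/σX + μY/σY)²` and
`λ₋ = (n/(2(1-ρ)))(μX/σX - μY/σY)²`. -/
theorem sumProdNormal_prob_nonpos (μX μY σX σY ρ : ℝ) (hσX : 0 < σX) (hσY : 0 < σY)
    (hρ : ρ ∈ Set.Ioo (-1 : ℝ) 1) (n : ℕ) (hn : 1 ≤ n) :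
    ((sumProdNormal n μX μY σX σY ρ) (Set.Iic 0)).toReal =
      Real.exp (-(((n : ℝ) / (2 * (1 + ρ)) * (μX / σX + μY / σY) ^ 2) +
          ((n : ℝ) / (2 * (1 - ρ)) * (μX / σX - μY / σY) ^ 2)) / 2) *
        ∑' j : ℕ, ∑' k : ℕ,
          1 / ((j.factorial : ℝ) * (k.factorial : ℝ)) *
            (((n : ℝ) / (2 * (1 + ρ)) * (μX / σX + μY / σY) ^ 2) / 2) ^ j *
            (((n : ℝ) / (2 * (1 - ρ)) * (μX / σX - μY / σY) ^ 2) / 2) ^ k *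
            regIncBeta ((1 - ρ) / 2) ((n : ℝ) / 2 + (j : ℝ)) ((n : ℝ) / 2 + (k : ℝ)) := by
  have hρ1 : 0 < 1 + ρ := by linarith [hρ.1]
  have hρ2 : 0 < 1 - ρ := by linarith [hρ.2]
  have hn0 : (0 : ℝ) < n := by exact_mod_cast hn
  have hpre : (fun p : ℝ × ℝ =>
      σX * σY * (1 + ρ) / 2 * p.1 - σX * σY * (1 - ρ) / 2 * p.2) ⁻¹' Set.Iic 0 =
      {z | (1 - (1 - ρ) / 2) * z.1 ≤ (1 - ρ) / 2 * z.2} := by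
    ext z
    rw [Set.mem_preimage, Set.mem_Iic, Set.mem_ofPred_eq,
      ← mul_le_mul_iff_right₀ (b := (1 - (1 - ρ) / 2) * z.1) (mul_pos hσX hσY)]
    constructor <;> intro h <;> linarith
  rw [sumProdNormal_eq_map_sub μX μY hσX hσY hρ hn,
    Measure.map_apply (by fun_prop) measurableSet_Iic, hpre]
  exact toReal_ncChiSqMixture_prod hn0 (by positivity) (by positivity) (by linarith)
    (by linarith)

end
end
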